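/- arXiv:1802.08498 — 2 statements merged into one kernel-verified Lean document; each statement's English description precedes it below -/
import Mathlib

section
/- Assume that the quotient ring ℂ[x_0,…,x_M]/(I + (r_1,…,r_n)) has Krull dimension at most 1, where I + (r_1,…,r_n) is the ideal generated by I together with r_1,…,r_n. Then there exists a constant Δ̃ ∈ ℤ_{≥0} such that Δ^𝐢_N ≤ Δ̃ for all 𝐢 ∈ ℤ_{≥0}^n and all integers N with N − ‖𝐢‖ ≥ 0. -/
open MvPolynomial

noncomputable section

/-- The degree-`d` homogeneous part `ℂ[x]_d` of `ℂ[x_0,…,x_M]`. -/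
def homogPart (M d : ℕ) : Submodule ℂ (MvPolynomial (Fin (M + 1)) ℂ) :=
  homogeneousSubmodule (Fin (M + 1)) ℂ d

/-- `‖𝐢‖ = i_1 + ⋯ + i_n`. -/
def normI {n : ℕ} (i : Fin n → ℕ) : ℕ := ∑ j, i j

/-- `r^𝐢 = r_1^{i_1} ⋯ r_n^{i_n}`. -/
def rPow {M n : ℕ} (r : Fin n → MvPolynomial (Fin (M + 1)) ℂ) (i : Fin n → ℕ) :
    MvPolynomial (Fin (M + 1)) ℂ := ∏ j, (r j) ^ (i j)

/-- The space `I^𝐢_N`: all `p ∈ ℂ[x]_{N-‖𝐢‖}` such that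
`r^𝐢·p - Σ_{𝐞 >_lex 𝐢, ‖𝐞‖ ≤ N} r^𝐞·c 𝐞 ∈ I_N = I ∩ ℂ[x]_N` for suitable
`c 𝐞 ∈ ℂ[x]_{N-‖𝐞‖}`. -/
def IfilSet (M n : ℕ) (I : Ideal (MvPolynomial (Fin (M + 1)) ℂ))
    (r : Fin n → MvPolynomial (Fin (M + 1)) ℂ) (i : Fin n → ℕ) (N : ℕ) :
    Set (MvPolynomial (Fin (M + 1)) ℂ) :=
  {p | p ∈ homogPart M (N - normI i) ∧
    ∃ (s : Finset (Fin n → ℕ)) (c : (Fin n → ℕ) → MvPolynomial (Fin (M + 1)) ℂ),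
      (∀ e ∈ s, toLex i < toLex e ∧ normI e ≤ N ∧ c e ∈ homogPart M (N - normI e)) ∧
      (rPow r i * p - ∑ e ∈ s, rPow r e * c e ∈ I ∧
        rPow r i * p - ∑ e ∈ s, rPow r e * c e ∈ homogPart M N)}

/-- The ideal `I^𝐢` generated by `⋃_{N ≥ ‖𝐢‖} I^𝐢_N`. -/
def Iideal (M n : ℕ) (I : Ideal (MvPolynomial (Fin (M + 1)) ℂ))
    (r : Fin n → MvPolynomial (Fin (M + 1)) ℂ) (i : Fin n → ℕ) :
    Ideal (MvPolynomial (Fin (M + 1)) ℂ) :=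
  Ideal.span {p | ∃ N, normI i ≤ N ∧ p ∈ IfilSet M n I r i N}

/-- `Δ^𝐢_N = dim_ℂ (ℂ[x]_{N-‖𝐢‖} / I^𝐢_N)`. -/
def Delta (M n : ℕ) (I : Ideal (MvPolynomial (Fin (M + 1)) ℂ))
    (r : Fin n → MvPolynomial (Fin (M + 1)) ℂ) (i : Fin n → ℕ) (N : ℕ) : ℕ :=
  Module.finrank ℂ
    (↥(homogPart M (N - normI i)) ⧸
      (Submodule.span ℂ (IfilSet M n I r i N)).comap (homogPart M (N - normI i)).subtype)

/-- `dim_ℂ (ℂ[x]_N / I_N)`, the Hilbert function of `I`. -/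
def DeltaV (M : ℕ) (I : Ideal (MvPolynomial (Fin (M + 1)) ℂ)) (N : ℕ) : ℕ :=
  Module.finrank ℂ
    (↥(homogPart M N) ⧸ (I.restrictScalars ℂ).comap (homogPart M N).subtype)

/-- `τ_N = {𝐢 ∈ ℤ_{≥0}^n : ‖𝐢‖ ≤ N}` as a `Finset`. -/
def tauN (n N : ℕ) : Finset (Fin n → ℕ) :=
  (Fintype.piFinset fun _ : Fin n => Finset.range (N + 1)).filter fun i => normI i ≤ N

/-- The ideal `I` is homogeneous: it contains every homogeneous component of its members. -/
def IsHomogeneousIdeal {M : ℕ} (I : Ideal (MvPolynomial (Fin (M + 1)) ℂ)) : Prop :=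
  ∀ p ∈ I, ∀ d : ℕ, homogeneousComponent d p ∈ I

end

section GradedIdeals

attribute [local instance] MvPolynomial.gradedAlgebra

variable {σ K : Type*}

lemma MvPolynomial.coe_decompose_homogeneousSubmodule [CommRing K] (p : MvPolynomial σ K) (d : ℕ) :
    (DirectSum.decompose (homogeneousSubmodule σ K) p d : MvPolynomial σ K) =
      homogeneousComponent d p :=
  decomposition.decompose'_apply p d

lemma MvPolynomial.homogeneousComponent_succ_mul_of_isHomogeneous_one [CommRing K]
    {l : MvPolynomial σ K} (hl : l.IsHomogeneous 1) (q : MvPolynomial σ K) (d : ℕ) :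
    homogeneousComponent (d + 1) (l * q) = l * homogeneousComponent d q := by
  rw [add_comm, ← coe_decompose_homogeneousSubmodule, ← coe_decompose_homogeneousSubmodule]
  exact DirectSum.coe_decompose_mul_add_of_left_mem (homogeneousSubmodule σ K) hl

lemma MvPolynomial.homogeneousComponent_zero_mul_of_isHomogeneous_one [CommRing K]
    {l : MvPolynomial σ K} (hl : l.IsHomogeneous 1) (q : MvPolynomial σ K) :
    homogeneousComponent 0 (l * q) = 0 := by
  rw [← coe_decompose_homogeneousSubmodule]
  exact DirectSum.coe_decompose_mul_of_left_mem_of_not_le (homogeneousSubmodule σ K) hl (by simp)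

lemma MvPolynomial.isHomogeneous_ideal_of_homogeneousComponent_mem [CommRing K]
    {I : Ideal (MvPolynomial σ K)} (h : ∀ p ∈ I, ∀ d : ℕ, homogeneousComponent d p ∈ I) :
    I.IsHomogeneous (homogeneousSubmodule σ K) :=
  fun d p hp => by
    rw [coe_decompose_homogeneousSubmodule]
    exact h p hp d

lemma Ideal.IsHomogeneous.of_mem_minimalPrimes [CommRing K] {J P : Ideal (MvPolynomial σ K)}
    (hJ : J.IsHomogeneous (homogeneousSubmodule σ K)) (hP : P ∈ J.minimalPrimes) :
    P.IsHomogeneous (homogeneousSubmodule σ K) := by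
  have hle := Ideal.toIdeal_homogeneousCore_le (homogeneousSubmodule σ K) P
  have hJle : J ≤ (P.homogeneousCore (homogeneousSubmodule σ K)).toIdeal := by
    rw [← hJ.toIdeal_homogeneousCore_eq_self]
    exact Ideal.homogeneousCore_mono (homogeneousSubmodule σ K) hP.1.2
  have hcore : (P.homogeneousCore (homogeneousSubmodule σ K)).toIdeal = P :=
    le_antisymm hle (hP.2 ⟨hP.1.1.homogeneousCore, hJle⟩ hle)
  exact (Ideal.IsHomogeneous.iff_eq _ P).2 hcore

lemma Ideal.IsHomogeneous.le_ker_constantCoeff [Field K] {Q : Ideal (MvPolynomial σ K)}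
    (hQ : Q.IsHomogeneous (homogeneousSubmodule σ K)) (hne : Q ≠ ⊤) :
    Q ≤ RingHom.ker (constantCoeff (R := K) (σ := σ)) := by
  intro p hp
  by_contra hc
  have h0 := MvPolynomial.homogeneousComponent_mem_of_mem hQ hp 0
  rw [homogeneousComponent_zero] at h0
  refine hne (Ideal.eq_top_of_isUnit_mem Q h0 ?_)
  exact (isUnit_iff_ne_zero.2 hc).map C

/-- Over an infinite field, some linear form lies in none of finitely many primes, provided
each of them misses some variable. -/
lemma MvPolynomial.exists_isHomogeneous_one_notMem [Field K] [Infinite K]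
    {S : Set (Ideal (MvPolynomial σ K))} (hS : S.Finite)
    (hX : ∀ P ∈ S, ∃ i, (X i : MvPolynomial σ K) ∉ P) :
    ∃ l : MvPolynomial σ K, l.IsHomogeneous 1 ∧ ∀ P ∈ S, l ∉ P := by
  classical
  let f : Ideal (MvPolynomial σ K) → Subspace K (homogeneousSubmodule σ K 1) :=
    fun P => (P.restrictScalars K).comap (homogeneousSubmodule σ K 1).subtype
  have htop : ⊤ ∉ hS.toFinset.image f := by
    intro h
    obtain ⟨P, hP, hPtop⟩ := Finset.mem_image.1 h
    obtain ⟨i, hi⟩ := hX P (hS.mem_toFinset.1 hP)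
    have : (⟨X i, isHomogeneous_X K i⟩ : homogeneousSubmodule σ K 1) ∈ f P := hPtop ▸ trivial
    exact hi this
  obtain ⟨l, hl⟩ := (Set.ne_univ_iff_exists_notMem _).1
    (Subspace.biUnion_ne_univ_of_top_notMem htop)
  refine ⟨l, l.2, fun P hP hlP => hl ?_⟩
  exact Set.mem_biUnion (Finset.mem_coe.2 (Finset.mem_image_of_mem f (hS.mem_toFinset.2 hP))) hlP

lemma Ideal.not_lt_lt_of_ringKrullDim_quotient_le_one {R : Type*} [CommRing R]
    {J P Q T : Ideal R} (hdim : ringKrullDim (R ⧸ J) ≤ 1) (hJP : J ≤ P) [hP : P.IsPrime]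
    [hQ : Q.IsPrime] [hT : T.IsPrime] (hPQ : P < Q) : ¬ Q < T := by
  intro hQT
  rw [ringKrullDim_quotient] at hdim
  let x : PrimeSpectrum.zeroLocus (J : Set R) := ⟨⟨P, hP⟩, hJP⟩
  let y : PrimeSpectrum.zeroLocus (J : Set R) := ⟨⟨Q, hQ⟩, hJP.trans hPQ.le⟩
  let z : PrimeSpectrum.zeroLocus (J : Set R) := ⟨⟨T, hT⟩, (hJP.trans hPQ.le).trans hQT.le⟩
  have hxy : x < y := hPQ
  have hyz : y < z := hQT
  let s : LTSeries (PrimeSpectrum.zeroLocus (J : Set R)) :=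
    { length := 2
      toFun := ![x, y, z]
      step := fun i => by fin_cases i <;> [exact hxy; exact hyz] }
  have h : ((2 : ℕ) : WithBot ℕ∞) ≤ ((1 : ℕ) : WithBot ℕ∞) :=
    (Order.LTSeries.length_le_krullDim s).trans hdim
  exact absurd (by exact_mod_cast h : (2 : ℕ) ≤ 1) (by norm_num)

/-- A homogeneous ideal of coheight at most one becomes primary to the irrelevant ideal (or the
unit ideal) after adding a suitable linear form. -/
lemma Ideal.IsHomogeneous.exists_idealOfVars_pow_le_sup_span [Field K] [Infinite K] [Finite σ]
    {J : Ideal (MvPolynomial σ K)} (hJ : J.IsHomogeneous (homogeneousSubmodule σ K))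
    (hdim : ringKrullDim (MvPolynomial σ K ⧸ J) ≤ 1) :
    ∃ l : MvPolynomial σ K, l.IsHomogeneous 1 ∧
      ∃ k, idealOfVars σ K ^ k ≤ J ⊔ Ideal.span {l} := by
  obtain ⟨l, hl, hlP⟩ := MvPolynomial.exists_isHomogeneous_one_notMem
    (S := {P ∈ J.minimalPrimes | ∃ i, (X i : MvPolynomial σ K) ∉ P})
    (J.finite_minimalPrimes_of_isNoetherianRing.subset (Set.sep_subset _ _)) (fun P hP => hP.2)
  refine ⟨l, hl, Ideal.exists_pow_le_of_le_radical_of_fg ?_ (idealOfVars_fg σ K)⟩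
  have hsup : (J ⊔ Ideal.span {l}).IsHomogeneous (homogeneousSubmodule σ K) :=
    hJ.sup (Ideal.homogeneous_span _ _ fun x hx => ⟨1, by
      rw [Set.mem_singleton_iff.1 hx]; exact hl⟩)
  rw [hsup.radical_eq, Ideal.span_le]
  rintro _ ⟨i, rfl⟩
  refine Ideal.mem_sInf.2 ?_
  rintro Q ⟨hQhom, hleQ, hQ⟩
  by_contra hi
  obtain ⟨P, hPmin, hPQ⟩ := Ideal.exists_minimalPrimes_le (le_sup_left.trans hleQ)
  have hlQ : l ∈ Q := hleQ (Ideal.mem_sup_right (Ideal.mem_span_singleton_self l))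
  have := hPmin.1.1
  have hlt : P < Q := lt_of_le_of_ne hPQ fun h =>
    hlP P ⟨hPmin, i, fun hX => hi (hPQ hX)⟩ (h ▸ hlQ)
  have hprime : (RingHom.ker (constantCoeff (R := K) (σ := σ))).IsPrime := RingHom.ker_isPrime _
  refine Ideal.not_lt_lt_of_ringKrullDim_quotient_le_one hdim hPmin.1.2 hlt
    (lt_of_le_of_ne (hQhom.le_ker_constantCoeff hQ.ne_top) fun h => hi ?_)
  rw [h]
  simp [RingHom.mem_ker]

end GradedIdeals

instance homogPart.finite (M d : ℕ) : Module.Finite ℂ (homogPart M d) :=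
  Module.Finite.iff_fg.2 (homogeneousSubmodule_fg _ _ d)

lemma DeltaV_succ_le {M d : ℕ} {J : Ideal (MvPolynomial (Fin (M + 1)) ℂ)}
    (hJ : IsHomogeneousIdeal J) {l : MvPolynomial (Fin (M + 1)) ℂ} (hl : l.IsHomogeneous 1)
    (hle : ∀ p ∈ homogPart M (d + 1), p ∈ J ⊔ Ideal.span {l}) :
    DeltaV M J (d + 1) ≤ DeltaV M J d := by
  let f : homogPart M d →ₗ[ℂ] homogPart M (d + 1) :=
    (LinearMap.mulLeft ℂ l).restrict fun q hq => by
      simpa [add_comm d] using! IsHomogeneous.mul hl hq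
  have hf : (J.restrictScalars ℂ).comap (homogPart M d).subtype ≤
      ((J.restrictScalars ℂ).comap (homogPart M (d + 1)).subtype).comap f :=
    fun q hq => J.mul_mem_left l hq
  refine LinearMap.finrank_le_finrank_of_surjective (f := Submodule.mapQ _ _ f hf) ?_
  intro y
  obtain ⟨⟨p, hp⟩, rfl⟩ := Submodule.Quotient.mk_surjective _ y
  obtain ⟨a, ha, b, hb, hab⟩ := Submodule.mem_sup.1 (hle p hp)
  obtain ⟨q, rfl⟩ := Ideal.mem_span_singleton'.1 hb
  refine ⟨Submodule.Quotient.mk ⟨homogeneousComponent d q, homogeneousComponent_mem d q⟩, ?_⟩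
  rw [Submodule.mapQ_apply, Submodule.Quotient.eq]
  change l * homogeneousComponent d q - p ∈ J
  have h := congrArg (homogeneousComponent (d + 1)) hab
  rw [map_add, homogeneousComponent_eq_self hp, mul_comm,
    homogeneousComponent_succ_mul_of_isHomogeneous_one hl] at h
  rw [← h, sub_add_cancel_right]
  exact J.neg_mem (hJ a ha _)

/-- The Hilbert function of a homogeneous ideal of coheight at most one is bounded. -/
lemma exists_DeltaV_le {M : ℕ} {J : Ideal (MvPolynomial (Fin (M + 1)) ℂ)}
    (hJ : IsHomogeneousIdeal J)
    (hdim : ringKrullDim (MvPolynomial (Fin (M + 1)) ℂ ⧸ J) ≤ 1) :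
    ∃ B : ℕ, ∀ d, DeltaV M J d ≤ B := by
  obtain ⟨l, hl, k, hk⟩ :=
    (isHomogeneous_ideal_of_homogeneousComponent_mem hJ).exists_idealOfVars_pow_le_sup_span hdim
  have hmono : AntitoneOn (DeltaV M J) (Set.Ici k) := by
    refine antitoneOn_of_succ_le Set.ordConnected_Ici fun d _ hd _ => ?_
    refine DeltaV_succ_le hJ hl fun p hp => hk ?_
    rw [mem_pow_idealOfVars_iff']
    intro x hx
    refine IsHomogeneous.coeff_eq_zero hp ?_
    have : k ≤ d := hd
    omega
  refine ⟨(Finset.range (k + 1)).sup (DeltaV M J), fun d => ?_⟩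
  rcases le_total d k with h | h
  · exact Finset.le_sup (Finset.mem_range.2 (by omega))
  · exact (hmono Set.self_mem_Ici h h).trans (Finset.le_sup (Finset.mem_range.2 (by omega)))

lemma isHomogeneous_rPow {M n : ℕ} {r : Fin n → MvPolynomial (Fin (M + 1)) ℂ}
    (hr : ∀ j, r j ∈ homogPart M 1) (i : Fin n → ℕ) : (rPow r i).IsHomogeneous (normI i) := by
  refine IsHomogeneous.prod _ _ _ fun j _ => ?_
  simpa using IsHomogeneous.pow (hr j) (i j)

lemma rPow_mul_mem_homogPart {M n : ℕ} {r : Fin n → MvPolynomial (Fin (M + 1)) ℂ}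
    (hr : ∀ j, r j ∈ homogPart M 1) {i : Fin n → ℕ} {N : ℕ} (hN : normI i ≤ N)
    {p : MvPolynomial (Fin (M + 1)) ℂ} (hp : p ∈ homogPart M (N - normI i)) :
    rPow r i * p ∈ homogPart M N := by
  have := IsHomogeneous.mul (isHomogeneous_rPow hr i) hp
  rwa [Nat.add_sub_cancel' hN] at this

lemma mem_IfilSet_of_mem {M n : ℕ} {I : Ideal (MvPolynomial (Fin (M + 1)) ℂ)}
    {r : Fin n → MvPolynomial (Fin (M + 1)) ℂ} (hr : ∀ j, r j ∈ homogPart M 1)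
    {i : Fin n → ℕ} {N : ℕ} (hN : normI i ≤ N) {p : MvPolynomial (Fin (M + 1)) ℂ} (hpI : p ∈ I)
    (hp : p ∈ homogPart M (N - normI i)) : p ∈ IfilSet M n I r i N := by
  refine ⟨hp, ∅, 0, by simp, ?_, ?_⟩
  · simpa using I.mul_mem_left _ hpI
  · simpa using rPow_mul_mem_homogPart hr hN hp

lemma mul_mem_IfilSet {M n : ℕ} {I : Ideal (MvPolynomial (Fin (M + 1)) ℂ)}
    {r : Fin n → MvPolynomial (Fin (M + 1)) ℂ} (hr : ∀ j, r j ∈ homogPart M 1)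
    {i : Fin n → ℕ} {N d : ℕ} (hN : N - normI i = d + 1) (j : Fin n)
    {q : MvPolynomial (Fin (M + 1)) ℂ} (hq : q ∈ homogPart M d) :
    r j * q ∈ IfilSet M n I r i N := by
  have hnorm : normI (i + Pi.single j 1) = normI i + 1 := by
    simp [normI, Finset.sum_add_distrib]
  have hpow : rPow r (i + Pi.single j 1) = rPow r i * r j := by
    simp only [rPow, Pi.add_apply, pow_add, Finset.prod_mul_distrib]
    congr 1
    rw [Finset.prod_eq_single j] <;> simp +contextual
  refine ⟨?_, {i + Pi.single j 1}, fun _ => q, ?_, ?_, ?_⟩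
  · rw [hN, add_comm d]
    exact IsHomogeneous.mul (hr j) hq
  · intro e he
    rw [Finset.mem_singleton.1 he]
    refine ⟨Pi.toLex_strictMono ?_, by omega, ?_⟩
    · exact lt_add_of_pos_right i (Pi.single_pos.2 one_pos)
    · rwa [hnorm, show N - (normI i + 1) = d by omega]
  · simp [hpow, mul_assoc]
  · simp [hpow, mul_assoc]

lemma mem_span_IfilSet {M n : ℕ} {I : Ideal (MvPolynomial (Fin (M + 1)) ℂ)}
    (hI : IsHomogeneousIdeal I) {r : Fin n → MvPolynomial (Fin (M + 1)) ℂ}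
    (hr : ∀ j, r j ∈ homogPart M 1) {i : Fin n → ℕ} {N : ℕ} (hN : normI i ≤ N)
    {p : MvPolynomial (Fin (M + 1)) ℂ} (hpJ : p ∈ I ⊔ Ideal.span (Set.range r))
    (hp : p ∈ homogPart M (N - normI i)) :
    p ∈ Submodule.span ℂ (IfilSet M n I r i N) := by
  obtain ⟨a, ha, b, hb, hab⟩ := Submodule.mem_sup.1 hpJ
  obtain ⟨c, rfl⟩ := Ideal.mem_span_range_iff_exists_fun.1 hb
  rw [← homogeneousComponent_eq_self hp, ← hab, map_add, map_sum]
  refine add_mem (Submodule.subset_span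
    (mem_IfilSet_of_mem hr hN (hI a ha _) (homogeneousComponent_mem _ a))) (sum_mem fun j _ => ?_)
  rw [mul_comm]
  rcases h : N - normI i with _ | d
  · rw [homogeneousComponent_zero_mul_of_isHomogeneous_one (hr j)]
    exact zero_mem _
  · rw [homogeneousComponent_succ_mul_of_isHomogeneous_one (hr j)]
    exact Submodule.subset_span (mul_mem_IfilSet hr h j (homogeneousComponent_mem d (c j)))

lemma Delta_le_DeltaV {M n : ℕ} {I : Ideal (MvPolynomial (Fin (M + 1)) ℂ)}
    (hI : IsHomogeneousIdeal I) {r : Fin n → MvPolynomial (Fin (M + 1)) ℂ}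
    (hr : ∀ j, r j ∈ homogPart M 1) {i : Fin n → ℕ} {N : ℕ} (hN : normI i ≤ N) :
    Delta M n I r i N ≤ DeltaV M (I ⊔ Ideal.span (Set.range r)) (N - normI i) := by
  have hle : ((I ⊔ Ideal.span (Set.range r)).restrictScalars ℂ).comap
      (homogPart M (N - normI i)).subtype ≤ (Submodule.span ℂ (IfilSet M n I r i N)).comap
        (homogPart M (N - normI i)).subtype :=
    fun p hp => mem_span_IfilSet hI hr hN hp p.2
  exact LinearMap.finrank_le_finrank_of_surjective (Submodule.factor_surjective hle)

lemma isHomogeneousIdeal_sup_span_range {M n : ℕ} {I : Ideal (MvPolynomial (Fin (M + 1)) ℂ)}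
    (hI : IsHomogeneousIdeal I) {r : Fin n → MvPolynomial (Fin (M + 1)) ℂ}
    (hr : ∀ j, r j ∈ homogPart M 1) :
    IsHomogeneousIdeal (I ⊔ Ideal.span (Set.range r)) := by
  let _ := MvPolynomial.gradedAlgebra (σ := Fin (M + 1)) (R := ℂ)
  intro p hp d
  refine homogeneousComponent_mem_of_mem ((isHomogeneous_ideal_of_homogeneousComponent_mem hI).sup
    (Ideal.homogeneous_span _ _ ?_)) hp d
  rintro _ ⟨j, rfl⟩
  exact ⟨1, hr j⟩

/-- If `ℂ[x]/(I + (r_1,…,r_n))` has Krull dimension at most `1`, then `Δ^𝐢_N` is bounded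
uniformly over all `𝐢 ∈ ℤ_{≥0}^n` and all `N` with `N - ‖𝐢‖ ≥ 0`. -/
theorem Delta_bounded (M n : ℕ) (hM : 1 ≤ M) (hn : 1 ≤ n)
    (I : Ideal (MvPolynomial (Fin (M + 1)) ℂ)) (hI : IsHomogeneousIdeal I)
    (r : Fin n → MvPolynomial (Fin (M + 1)) ℂ)
    (hr : ∀ j, r j ≠ 0 ∧ r j ∈ homogPart M 1)
    (hdim : ringKrullDim
      (MvPolynomial (Fin (M + 1)) ℂ ⧸ (I ⊔ Ideal.span (Set.range r))) ≤ 1) :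
    ∃ Δbar : ℕ, ∀ (i : Fin n → ℕ) (N : ℕ), normI i ≤ N → Delta M n I r i N ≤ Δbar := by
  have hr1 : ∀ j, r j ∈ homogPart M 1 := fun j => (hr j).2
  obtain ⟨B, hB⟩ := exists_DeltaV_le (isHomogeneousIdeal_sup_span_range hI hr1) hdim
  exact ⟨B, fun i N hN => (Delta_le_DeltaV hI hr1 hN).trans (hB _)⟩
end

section
/- Assume in addition that I is a prime ideal, that the Krull dimension of ℂ[x_0,…,x_M]/I equals n+1, and that the quotient ring ℂ[x_0,…,x_M]/(I + (r_1,…,r_n)) has Krull dimension at most 1. For each 𝐢 ∈ ℤ_{≥0}^n let Δ^𝐢 denote the eventual value of Δ^𝐢_N (which is independent of N once N − ‖𝐢‖ is sufficiently large), and set Δ_0 = min_{𝐢 ∈ ℤ_{≥0}^n} Δ^𝐢 (the minimum exists since only finitely many ideals I^𝐢 occur). Then lim_{N→∞} n!·dim_ℂ(ℂ[x]_N/I_N)/N^n exists and equals Δ_0; that is, Δ_0 equals the degree of the projective variety defined by I. -/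
open MvPolynomial

open Filter

section Counting

theorem mem_tauN {n N : ℕ} {i : Fin n → ℕ} : i ∈ tauN n N ↔ normI i ≤ N := by
  simp only [tauN, Finset.mem_filter, Fintype.mem_piFinset, Finset.mem_range, and_iff_right_iff_imp]
  intro h j
  exact Nat.lt_succ_of_le ((Finset.single_le_sum (f := i) (fun _ _ => Nat.zero_le _)
    (Finset.mem_univ j)).trans h)

theorem normI_add {n : ℕ} (i j : Fin n → ℕ) : normI (i + j) = normI i + normI j := by
  simp [normI, Finset.sum_add_distrib]

theorem card_tauN (n N : ℕ) : (tauN n N).card = (N + n).choose n := by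
  have h : (tauN n N).card =
      (Finset.finsuppAntidiag (Finset.univ : Finset (Fin (n + 1))) N).card := by
    refine Finset.card_bij'
      (fun i _ => Finsupp.equivFunOnFinite.symm (Fin.cons (N - normI i) i : Fin (n + 1) → ℕ))
      (fun f _ => Fin.tail (f : Fin (n + 1) → ℕ)) ?_ ?_ ?_ ?_
    · intro i hi
      rw [mem_tauN] at hi
      simp only [Finset.mem_finsuppAntidiag, Finset.subset_univ, and_true]
      simp only [Finsupp.equivFunOnFinite_symm_apply_apply, Fin.sum_univ_succ, Fin.cons_zero,
        Fin.cons_succ]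
      exact Nat.sub_add_cancel hi
    · intro f hf
      simp only [Finset.mem_finsuppAntidiag, Finset.subset_univ, and_true, Fin.sum_univ_succ] at hf
      rw [mem_tauN]
      change ∑ j : Fin n, f j.succ ≤ N
      omega
    · intro i _
      simp
    · intro f hf
      simp only [Finset.mem_finsuppAntidiag, Finset.subset_univ, and_true, Fin.sum_univ_succ] at hf
      have h0 : N - normI (Fin.tail (f : Fin (n + 1) → ℕ)) = f 0 := by
        change N - ∑ j : Fin n, f j.succ = f 0
        omega
      simp [h0]
  rw [h, Finset.card_finsuppAntidiag_nat_eq_choose, Finset.card_univ, Fintype.card_fin,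
    show n + 1 + N - 1 = N + n by omega, ← Nat.choose_symm_add]

/-- Shifted simplices have the same leading asymptotics `N ^ n / n!`. -/
theorem tendsto_factorial_mul_card_tauN_sub (n c : ℕ) :
    Tendsto (fun N : ℕ => (n.factorial : ℝ) * ((tauN n (N - c)).card : ℝ) / (N : ℝ) ^ n)
      atTop (nhds 1) := by
  rw [← tendsto_add_atTop_iff_nat c]
  have hz : ∀ᶠ m : ℕ in atTop, ((m : ℝ) ^ n / n.factorial : ℝ) ≠ 0 := by
    filter_upwards [eventually_gt_atTop 0] with m hm
    positivity
  have h1 := (Asymptotics.isEquivalent_iff_tendsto_one hz).1 (isEquivalent_choose n)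
  have h2 := h1.comp (tendsto_add_atTop_nat n)
  have hratio (a : ℕ) : Tendsto (fun m : ℕ => ((m : ℝ) / ((m + a : ℕ) : ℝ)) ^ n)
      atTop (nhds 1) := by
    simpa using (tendsto_natCast_div_add_atTop (a : ℝ)).pow n
  have h3 := (h2.div (hratio n) one_ne_zero).mul (hratio c)
  rw [div_one, mul_one] at h3
  refine h3.congr' ?_
  filter_upwards [eventually_gt_atTop 0] with m hm
  have hm' : (m : ℝ) ≠ 0 := by positivity
  have hmc : ((m + c : ℕ) : ℝ) ≠ 0 := by positivity
  have hmn : ((m + n : ℕ) : ℝ) ≠ 0 := by positivity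
  have hf : (n.factorial : ℝ) ≠ 0 := by positivity
  simp only [Pi.div_apply, Function.comp_apply, card_tauN, Nat.add_sub_cancel, div_pow]
  field_simp

end Counting

section LinearAlgebra

theorem finrank_sup_range {K V W : Type*} [Field K] [AddCommGroup V] [Module K V]
    [AddCommGroup W] [Module K W] (U : Submodule K W) (f : V →ₗ[K] W)
    [FiniteDimensional K U] [FiniteDimensional K V] :
    Module.finrank K ↥(U ⊔ LinearMap.range f) =
      Module.finrank K U + Module.finrank K (V ⧸ U.comap f) := by
  have h := (U.mkQ.domRestrict (U ⊔ LinearMap.range f)).finrank_range_add_finrank_ker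
  have hker : LinearMap.ker (U.mkQ.domRestrict (U ⊔ LinearMap.range f)) =
      U.comap (U ⊔ LinearMap.range f).subtype := by
    ext x
    simp
  have hrange : LinearMap.range (U.mkQ.domRestrict (U ⊔ LinearMap.range f)) =
      LinearMap.range (U.mkQ ∘ₗ f) := by
    rw [LinearMap.range_domRestrict, Submodule.map_sup, LinearMap.range_comp]
    simp
  have hker' : LinearMap.ker (U.mkQ ∘ₗ f) = U.comap f := by
    rw [LinearMap.ker_comp, Submodule.ker_mkQ]
  rw [hker, hrange, (Submodule.comapSubtypeEquivOfLe le_sup_left).finrank_eq,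
    ← (U.mkQ ∘ₗ f).quotKerEquivRange.finrank_eq, hker'] at h
  omega

end LinearAlgebra

section Filtration

variable {M n : ℕ}

instance finiteDimensional_homogPart (d : ℕ) : FiniteDimensional ℂ (homogPart M d) :=
  Submodule.finiteDimensional_of_le (S₂ := restrictTotalDegree (Fin (M + 1)) ℂ d) fun _ hp =>
    (mem_restrictTotalDegree _ _ _).2 (IsHomogeneous.totalDegree_le hp)

theorem rPow_mem {r : Fin n → MvPolynomial (Fin (M + 1)) ℂ} (hr : ∀ j, r j ∈ homogPart M 1)
    (i : Fin n → ℕ) : rPow r i ∈ homogPart M (normI i) := by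
  refine IsHomogeneous.prod _ _ _ fun j _ => ?_
  simpa using IsHomogeneous.pow (hr j) (i j)

theorem rPow_add (r : Fin n → MvPolynomial (Fin (M + 1)) ℂ) (i j : Fin n → ℕ) :
    rPow r (i + j) = rPow r i * rPow r j := by
  simp [rPow, pow_add, Finset.prod_mul_distrib]

theorem mul_mem_homogPart {a b N : ℕ} {p q : MvPolynomial (Fin (M + 1)) ℂ}
    (hp : p ∈ homogPart M a) (hq : q ∈ homogPart M b) (h : a + b = N) : p * q ∈ homogPart M N :=
  h ▸ IsHomogeneous.mul hp hq

theorem homogeneousComponent_mul_of_right {d : ℕ} (p : MvPolynomial (Fin (M + 1)) ℂ)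
    {q : MvPolynomial (Fin (M + 1)) ℂ} (hq : q ∈ homogPart M d) (N : ℕ) :
    homogeneousComponent N (p * q) =
      if d ≤ N then homogeneousComponent (N - d) p * q else 0 := by
  conv_lhs => rw [← sum_homogeneousComponent p]
  conv_rhs => rw [← sum_homogeneousComponent p]
  rw [Finset.sum_mul, map_sum, map_sum, Finset.sum_mul]
  split_ifs with h
  · refine Finset.sum_congr rfl fun k _ => ?_
    rw [homogeneousComponent_of_mem (IsHomogeneous.mul (homogeneousComponent_mem k p) hq),
      homogeneousComponent_of_mem (homogeneousComponent_mem k p), ite_mul, zero_mul]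
    refine if_congr ?_ rfl rfl
    omega
  · refine Finset.sum_eq_zero fun k _ => ?_
    rw [homogeneousComponent_of_mem (IsHomogeneous.mul (homogeneousComponent_mem k p) hq),
      if_neg (by omega)]

/-- The ideal `(I + (r^𝐞 : 𝐞 > 𝐢)) : r^𝐢`, whose homogeneous parts are the spaces `I^𝐢_N`. -/
noncomputable def colonIdeal (I : Ideal (MvPolynomial (Fin (M + 1)) ℂ))
    (r : Fin n → MvPolynomial (Fin (M + 1)) ℂ) (i : Fin n → ℕ) :
    Ideal (MvPolynomial (Fin (M + 1)) ℂ) :=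
  Submodule.comap (LinearMap.mulLeft (MvPolynomial (Fin (M + 1)) ℂ) (rPow r i))
    (I ⊔ Ideal.span (Set.range fun e : {e : Fin n → ℕ // toLex i < toLex e} => rPow r e))

theorem mem_colonIdeal {I : Ideal (MvPolynomial (Fin (M + 1)) ℂ)}
    {r : Fin n → MvPolynomial (Fin (M + 1)) ℂ} {i : Fin n → ℕ}
    {p : MvPolynomial (Fin (M + 1)) ℂ} :
    p ∈ colonIdeal I r i ↔ rPow r i * p ∈
      I ⊔ Ideal.span (Set.range fun e : {e : Fin n → ℕ // toLex i < toLex e} => rPow r e) :=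
  Iff.rfl

theorem colonIdeal_le_add (I : Ideal (MvPolynomial (Fin (M + 1)) ℂ))
    (r : Fin n → MvPolynomial (Fin (M + 1)) ℂ) (i f : Fin n → ℕ) :
    colonIdeal I r i ≤ colonIdeal I r (i + f) := by
  intro p hp
  rw [mem_colonIdeal] at hp ⊢
  have h : rPow r (i + f) * p = rPow r f * (rPow r i * p) := by
    rw [rPow_add]
    ring
  rw [h]
  obtain ⟨a, ha, b, hb, hab⟩ := Submodule.mem_sup.1 hp
  rw [← hab, mul_add]
  refine Submodule.add_mem_sup (I.mul_mem_left _ ha) ?_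
  have hle : Ideal.span (Set.range fun e : {e : Fin n → ℕ // toLex i < toLex e} => rPow r e) ≤
      Submodule.comap (LinearMap.mulLeft (MvPolynomial (Fin (M + 1)) ℂ) (rPow r f))
        (Ideal.span (Set.range fun e : {e : Fin n → ℕ // toLex (i + f) < toLex e} =>
          rPow r e)) := by
    rw [Ideal.span_le]
    rintro _ ⟨e, rfl⟩
    refine Ideal.subset_span ⟨⟨e.1 + f, ?_⟩, ?_⟩
    · rw [toLex_add, toLex_add]
      exact add_lt_add_left e.2 _
    · simp [rPow_add, mul_comm]
  exact hle hb

/-- Multiplication by `r^𝐢`, from `ℂ[x]_{N-‖𝐢‖}`. -/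
noncomputable def mulRPow (r : Fin n → MvPolynomial (Fin (M + 1)) ℂ) (N : ℕ) (i : Fin n → ℕ) :
    homogPart M (N - normI i) →ₗ[ℂ] MvPolynomial (Fin (M + 1)) ℂ :=
  (LinearMap.mulLeft ℂ (rPow r i)).domRestrict _

@[simp]
theorem mulRPow_apply (r : Fin n → MvPolynomial (Fin (M + 1)) ℂ) (N : ℕ) (i : Fin n → ℕ)
    (p : homogPart M (N - normI i)) : mulRPow r N i p = rPow r i * p := rfl

/-- The subspace `I_N + Σ_{𝐞 ∈ S} r^𝐞 ℂ[x]_{N-‖𝐞‖}`. -/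
noncomputable def filtSpan (I : Ideal (MvPolynomial (Fin (M + 1)) ℂ))
    (r : Fin n → MvPolynomial (Fin (M + 1)) ℂ) (N : ℕ) (S : Finset (Lex (Fin n → ℕ))) :
    Submodule ℂ (MvPolynomial (Fin (M + 1)) ℂ) :=
  (I.restrictScalars ℂ ⊓ homogPart M N) ⊔ ⨆ e ∈ S, LinearMap.range (mulRPow r N (ofLex e))

/-- The index set `τ_N`, with the lexicographic order. -/
def tauLex (n N : ℕ) : Finset (Lex (Fin n → ℕ)) := (tauN n N).map toLex.toEmbedding

theorem mem_tauLex {N : ℕ} {e : Lex (Fin n → ℕ)} : e ∈ tauLex n N ↔ normI (ofLex e) ≤ N := by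
  rw [← mem_tauN]
  constructor
  · intro h
    obtain ⟨i, hi, rfl⟩ := Finset.mem_map.1 h
    exact hi
  · intro h
    exact Finset.mem_map.2 ⟨_, h, rfl⟩

open Classical in
/-- The elements of `τ_N` above `a` in the lexicographic order. -/
noncomputable def tauGt (N : ℕ) (a : Lex (Fin n → ℕ)) : Finset (Lex (Fin n → ℕ)) :=
  (tauLex n N).filter (a < ·)

theorem mem_tauGt {N : ℕ} {a e : Lex (Fin n → ℕ)} :
    e ∈ tauGt N a ↔ e ∈ tauLex n N ∧ a < e := by
  simp [tauGt]

theorem mul_mem_filtSpan (I : Ideal (MvPolynomial (Fin (M + 1)) ℂ))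
    (r : Fin n → MvPolynomial (Fin (M + 1)) ℂ) {N : ℕ} {S : Finset (Lex (Fin n → ℕ))}
    {e : Fin n → ℕ} (he : toLex e ∈ S) {p : MvPolynomial (Fin (M + 1)) ℂ}
    (hp : p ∈ homogPart M (N - normI e)) : rPow r e * p ∈ filtSpan I r N S :=
  Submodule.mem_sup_right <|
    (le_iSup₂ (f := fun e (_ : e ∈ S) => LinearMap.range (mulRPow r N (ofLex e))) _ he)
      ⟨⟨p, hp⟩, rfl⟩

variable {I : Ideal (MvPolynomial (Fin (M + 1)) ℂ)} {r : Fin n → MvPolynomial (Fin (M + 1)) ℂ}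

theorem filtSpan_empty (N : ℕ) :
    filtSpan I r N ∅ = I.restrictScalars ℂ ⊓ homogPart M N :=
  sup_eq_left.2 (iSup₂_le fun e he => absurd he (Finset.notMem_empty e))

theorem filtSpan_le (hr : ∀ j, r j ∈ homogPart M 1) {N : ℕ} {S : Finset (Lex (Fin n → ℕ))}
    (hS : S ⊆ tauLex n N) : filtSpan I r N S ≤ homogPart M N := by
  refine sup_le inf_le_right (iSup₂_le fun e he => ?_)
  rintro _ ⟨p, rfl⟩
  exact mul_mem_homogPart (rPow_mem hr _) p.2 (Nat.add_sub_cancel' (mem_tauLex.1 (hS he)))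

theorem mem_colonIdeal_of_mem_IfilSet {i : Fin n → ℕ} {N : ℕ}
    {p : MvPolynomial (Fin (M + 1)) ℂ} (hp : p ∈ IfilSet M n I r i N) :
    p ∈ colonIdeal I r i := by
  obtain ⟨-, s, c, hs, hI, -⟩ := hp
  rw [mem_colonIdeal, ← sub_add_cancel (rPow r i * p) (∑ e ∈ s, rPow r e * c e)]
  refine Submodule.add_mem_sup hI (Ideal.sum_mem _ fun e he => ?_)
  exact Ideal.mul_mem_right _ _ (Ideal.subset_span ⟨⟨e, (hs e he).1⟩, rfl⟩)

theorem mem_filtSpan_of_mem_colonIdeal (hI : IsHomogeneousIdeal I)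
    (hr : ∀ j, r j ∈ homogPart M 1) {i : Fin n → ℕ} {N : ℕ} (hi : normI i ≤ N)
    {p : MvPolynomial (Fin (M + 1)) ℂ} (hp : p ∈ homogPart M (N - normI i))
    (hpc : p ∈ colonIdeal I r i) :
    rPow r i * p ∈ filtSpan I r N (tauGt N (toLex i)) := by
  have hhom : rPow r i * p ∈ homogPart M N :=
    mul_mem_homogPart (rPow_mem hr _) hp (Nat.add_sub_cancel' hi)
  obtain ⟨a, ha, b, hb, hab⟩ := Submodule.mem_sup.1 (mem_colonIdeal.1 hpc)
  obtain ⟨c, rfl⟩ := Finsupp.mem_ideal_span_range_iff_exists_finsupp.1 hb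
  rw [← homogeneousComponent_eq_self hhom, ← hab, map_add]
  refine Submodule.add_mem _ (Submodule.mem_sup_left ⟨hI a ha N, homogeneousComponent_mem N a⟩) ?_
  rw [Finsupp.sum, map_sum]
  refine Submodule.sum_mem _ fun e _ => ?_
  rw [homogeneousComponent_mul_of_right _ (rPow_mem hr _)]
  split_ifs with h
  · rw [mul_comm]
    exact mul_mem_filtSpan I r (mem_tauGt.2 ⟨mem_tauLex.2 h, e.2⟩)
      (homogeneousComponent_mem _ _)
  · exact Submodule.zero_mem _

theorem mem_IfilSet_of_mem_filtSpan {i : Fin n → ℕ} {N : ℕ}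
    {p : MvPolynomial (Fin (M + 1)) ℂ} (hp : p ∈ homogPart M (N - normI i))
    (h : rPow r i * p ∈ filtSpan I r N (tauGt N (toLex i))) :
    p ∈ IfilSet M n I r i N := by
  obtain ⟨a, ha, b, hb, hab⟩ := Submodule.mem_sup.1 h
  obtain ⟨μ, rfl⟩ := (Submodule.mem_iSup_finset_iff_exists_sum _ _).1 hb
  choose c hc using fun e => (μ e).2
  refine ⟨hp, (tauGt N (toLex i)).map ofLex.toEmbedding,
    fun e => c (toLex e), ?_, ?_⟩
  · intro e he
    obtain ⟨e', he', rfl⟩ := Finset.mem_map.1 he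
    obtain ⟨h1, h2⟩ := mem_tauGt.1 he'
    exact ⟨h2, mem_tauLex.1 h1, (c e').2⟩
  · have hsum : rPow r i * p - ∑ e ∈ (tauGt N (toLex i)).map ofLex.toEmbedding,
        rPow r e * (c (toLex e) : MvPolynomial (Fin (M + 1)) ℂ) = a := by
      rw [← hab, Finset.sum_map, sub_eq_iff_eq_add]
      congr 1
      exact Finset.sum_congr rfl fun e _ => (hc e).symm
    rw [hsum]
    exact ha

theorem Delta_eq_DeltaV (hI : IsHomogeneousIdeal I) (hr : ∀ j, r j ∈ homogPart M 1)
    {i : Fin n → ℕ} {N : ℕ} (hi : normI i ≤ N) :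
    Delta M n I r i N = DeltaV M (colonIdeal I r i) (N - normI i) := by
  have h : IfilSet M n I r i N =
      ↑((colonIdeal I r i).restrictScalars ℂ ⊓ homogPart M (N - normI i)) := by
    ext p
    refine ⟨fun hp => ⟨mem_colonIdeal_of_mem_IfilSet hp, hp.1⟩, fun hp => ?_⟩
    exact mem_IfilSet_of_mem_filtSpan hp.2 (mem_filtSpan_of_mem_colonIdeal hI hr hi hp.2 hp.1)
  have h' : ((colonIdeal I r i).restrictScalars ℂ ⊓ homogPart M (N - normI i)).comap
      (homogPart M (N - normI i)).subtype =
      ((colonIdeal I r i).restrictScalars ℂ).comap (homogPart M (N - normI i)).subtype := by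
    ext p
    simp
  rw [Delta, DeltaV, h, Submodule.span_eq, h']

theorem comap_mulRPow_filtSpan (hI : IsHomogeneousIdeal I) (hr : ∀ j, r j ∈ homogPart M 1)
    {i : Fin n → ℕ} {N : ℕ} (hi : normI i ≤ N) :
    (filtSpan I r N (tauGt N (toLex i))).comap (mulRPow r N i) =
      ((colonIdeal I r i).restrictScalars ℂ).comap (homogPart M (N - normI i)).subtype := by
  ext p
  exact ⟨fun h => mem_colonIdeal_of_mem_IfilSet (mem_IfilSet_of_mem_filtSpan p.2 h),
    fun h => mem_filtSpan_of_mem_colonIdeal hI hr hi p.2 h⟩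

theorem finrank_filtSpan (hI : IsHomogeneousIdeal I) (hr : ∀ j, r j ∈ homogPart M 1) (N : ℕ)
    (S : Finset (Lex (Fin n → ℕ))) (hS : S ⊆ tauLex n N)
    (hup : ∀ a ∈ S, ∀ b ∈ tauLex n N, a < b → b ∈ S) :
    Module.finrank ℂ (filtSpan I r N S) =
      Module.finrank ℂ ↥(I.restrictScalars ℂ ⊓ homogPart M N) +
        ∑ e ∈ S, DeltaV M (colonIdeal I r (ofLex e)) (N - normI (ofLex e)) := by
  induction S using Finset.induction_on_min with
  | empty =>
    rw [Finset.sum_empty, add_zero, filtSpan_empty]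
  | insert a S ha ih =>
    have haS : a ∉ S := fun h => (ha a h).false
    have hS' : S ⊆ tauLex n N := (Finset.subset_insert _ _).trans hS
    have haτ : a ∈ tauLex n N := hS (Finset.mem_insert_self _ _)
    have hSeq : S = tauGt N (toLex (ofLex a)) := by
      ext x
      rw [mem_tauGt]
      refine ⟨fun hx => ⟨hS' hx, ha x hx⟩, fun hx => ?_⟩
      exact (Finset.mem_insert.1 (hup a (Finset.mem_insert_self _ _) x hx.1 hx.2)).resolve_left
        hx.2.ne'
    have hup' : ∀ x ∈ S, ∀ y ∈ tauLex n N, x < y → y ∈ S := fun x hx y hy hxy =>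
      (Finset.mem_insert.1 (hup x (Finset.mem_insert_of_mem hx) y hy hxy)).resolve_left
        ((ha x hx).trans hxy).ne'
    have hfd : FiniteDimensional ℂ (filtSpan I r N S) :=
      Submodule.finiteDimensional_of_le (filtSpan_le hr hS')
    have hins : filtSpan I r N (insert a S) =
        filtSpan I r N S ⊔ LinearMap.range (mulRPow r N (ofLex a)) := by
      rw [filtSpan, filtSpan, Finset.iSup_insert, sup_comm (LinearMap.range _), sup_assoc]
    have hcomap := comap_mulRPow_filtSpan (I := I) hI hr (mem_tauLex.1 haτ)
    rw [← hSeq] at hcomap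
    rw [hins, finrank_sup_range, ih hS' hup', Finset.sum_insert haS, hcomap, DeltaV]
    omega

theorem filtSpan_tauLex (hr : ∀ j, r j ∈ homogPart M 1) (N : ℕ) :
    filtSpan I r N (tauLex n N) = homogPart M N := by
  refine le_antisymm (filtSpan_le hr subset_rfl) fun p hp => ?_
  have h := mul_mem_filtSpan I r (N := N) (S := tauLex n N) (e := 0) (p := p)
    (mem_tauLex.2 (show normI 0 ≤ N by simp [normI])) (by simpa [normI] using hp)
  simpa [rPow] using h

/-- The Hilbert function of `I` is the sum of the dimensions of the graded pieces. -/
theorem DeltaV_eq_sum (hI : IsHomogeneousIdeal I) (hr : ∀ j, r j ∈ homogPart M 1) (N : ℕ) :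
    DeltaV M I N = ∑ i ∈ tauN n N, DeltaV M (colonIdeal I r i) (N - normI i) := by
  have hfd : FiniteDimensional ℂ ↥(I.restrictScalars ℂ ⊓ homogPart M N) :=
    Submodule.finiteDimensional_of_le inf_le_right
  have h := finrank_filtSpan hI hr N (tauLex n N) subset_rfl fun _ _ _ h _ => h
  have h' := finrank_sup_range (I.restrictScalars ℂ ⊓ homogPart M N) (homogPart M N).subtype
  have hc : (I.restrictScalars ℂ ⊓ homogPart M N).comap (homogPart M N).subtype =
      (I.restrictScalars ℂ).comap (homogPart M N).subtype := by
    ext p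
    simp
  rw [Submodule.range_subtype, sup_eq_right.2 inf_le_right, hc] at h'
  rw [filtSpan_tauLex hr, h', tauLex, Finset.sum_map] at h
  exact Nat.add_left_cancel h

theorem DeltaV_anti {J₁ J₂ : Ideal (MvPolynomial (Fin (M + 1)) ℂ)} (h : J₁ ≤ J₂) (k : ℕ) :
    DeltaV M J₂ k ≤ DeltaV M J₁ k :=
  LinearMap.finrank_le_finrank_of_surjective
    (Submodule.factor_surjective (Submodule.comap_mono (f := (homogPart M k).subtype)
      (show J₁.restrictScalars ℂ ≤ J₂.restrictScalars ℂ from h)))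

theorem exists_colonIdeal_add_eq (I : Ideal (MvPolynomial (Fin (M + 1)) ℂ))
    (r : Fin n → MvPolynomial (Fin (M + 1)) ℂ) (i₀ : Fin n → ℕ) :
    ∃ f, ∀ g, colonIdeal I r (i₀ + f + g) = colonIdeal I r (i₀ + f) := by
  obtain ⟨_, ⟨f, rfl⟩, hf⟩ := set_has_maximal_iff_noetherian.2
    (inferInstance : IsNoetherian (MvPolynomial (Fin (M + 1)) ℂ) (MvPolynomial (Fin (M + 1)) ℂ))
    (Set.range fun f => colonIdeal I r (i₀ + f)) (Set.range_nonempty _)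
  refine ⟨f, fun g => ?_⟩
  have hle := colonIdeal_le_add I r (i₀ + f) g
  refine (hle.eq_or_lt.resolve_right fun hlt => ?_).symm
  exact hf _ ⟨f + g, rfl⟩ (by simpa only [add_assoc] using hlt)

end Filtration

/-- A sum over `τ_N` of bounded terms which are equal to `a` on a translate of `τ_{N-c}`. -/
theorem sum_tauN_bounds {n N c : ℕ} {i₁ : Fin n → ℕ} (hc : normI i₁ ≤ c) (hN : c ≤ N)
    {g : (Fin n → ℕ) → ℕ} {a B : ℕ} (hB : ∀ i, g i ≤ B)
    (ha : ∀ j ∈ tauN n (N - c), g (i₁ + j) = a) :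
    a * (tauN n (N - c)).card ≤ ∑ i ∈ tauN n N, g i ∧
      ∑ i ∈ tauN n N, g i + B * (tauN n (N - c)).card ≤
        a * (tauN n (N - c)).card + B * (tauN n N).card := by
  set G := (tauN n (N - c)).map (addLeftEmbedding i₁) with hG
  have hGsub : G ⊆ tauN n N := by
    intro i hi
    obtain ⟨j, hj, rfl⟩ := Finset.mem_map.1 hi
    rw [mem_tauN] at hj ⊢
    rw [addLeftEmbedding_apply, normI_add]
    omega
  have hGsum : ∑ i ∈ G, g i = a * (tauN n (N - c)).card := by
    rw [hG, Finset.sum_map]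
    simp only [addLeftEmbedding_apply]
    rw [Finset.sum_congr rfl ha, Finset.sum_const, smul_eq_mul, mul_comm]
  have hsplit := Finset.sum_sdiff (f := g) hGsub
  have hrest : ∑ i ∈ tauN n N \ G, g i ≤ (tauN n N \ G).card * B :=
    Finset.sum_le_card_nsmul _ _ _ fun i _ => hB i
  have hcard := Finset.card_sdiff_add_card_eq_card hGsub
  rw [show G.card = (tauN n (N - c)).card from Finset.card_map _] at hcard
  constructor
  · omega
  · nlinarith

/-- With `I` prime of Krull dimension `n+1` and `dim ℂ[x]/(I+(r_1,…,r_n)) ≤ 1`, the minimum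
`Δ_0` of the eventual values `Δ^𝐢` satisfies
`lim_{N→∞} n!·dim_ℂ(ℂ[x]_N/I_N)/N^n = Δ_0`, i.e. `Δ_0` is the degree of the variety of `I`. -/
theorem Delta0_eq_degree (M n : ℕ) (hM : 1 ≤ M) (hn : 1 ≤ n)
    (I : Ideal (MvPolynomial (Fin (M + 1)) ℂ)) (hI : IsHomogeneousIdeal I)
    (hprime : I.IsPrime)
    (hdimI : ringKrullDim (MvPolynomial (Fin (M + 1)) ℂ ⧸ I) = (n + 1 : ℕ))
    (r : Fin n → MvPolynomial (Fin (M + 1)) ℂ)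
    (hr : ∀ j, r j ≠ 0 ∧ r j ∈ homogPart M 1)
    (hdim : ringKrullDim
      (MvPolynomial (Fin (M + 1)) ℂ ⧸ (I ⊔ Ideal.span (Set.range r))) ≤ 1)
    (D : (Fin n → ℕ) → ℕ)
    (hD : ∀ i : Fin n → ℕ, ∃ N₁ : ℕ, ∀ N : ℕ, N₁ + normI i < N → Delta M n I r i N = D i)
    (Δ₀ : ℕ) (hΔ₀ : IsLeast (Set.range D) Δ₀) :
    Tendsto (fun N : ℕ => (n.factorial : ℝ) * (DeltaV M I N : ℝ) / (N : ℝ) ^ n)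
      atTop (nhds (Δ₀ : ℝ)) := by
  have hr' : ∀ j, r j ∈ homogPart M 1 := fun j => (hr j).2
  have hDV : ∀ i, ∃ K, ∀ k, K < k → DeltaV M (colonIdeal I r i) k = D i := by
    intro i
    obtain ⟨K, hK⟩ := hD i
    refine ⟨K, fun k hk => ?_⟩
    have h := hK (k + normI i) (by omega)
    rwa [Delta_eq_DeltaV hI hr' (by omega), Nat.add_sub_cancel] at h
  obtain ⟨⟨i₀, hi₀⟩, hmin⟩ := hΔ₀
  obtain ⟨f, hf⟩ := exists_colonIdeal_add_eq I r i₀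
  set i₁ := i₀ + f with hi₁
  obtain ⟨K₁, hK₁⟩ := hDV i₁
  have hDi₁ : D i₁ = Δ₀ := by
    refine le_antisymm ?_ (hmin ⟨i₁, rfl⟩)
    obtain ⟨K₀, hK₀⟩ := hDV i₀
    rw [← hi₀, ← hK₀ (K₀ + K₁ + 1) (by omega), ← hK₁ (K₀ + K₁ + 1) (by omega)]
    exact DeltaV_anti (colonIdeal_le_add I r i₀ f) _
  obtain ⟨B, hB⟩ : ∃ B, ∀ i k, DeltaV M (colonIdeal I r i) k ≤ B := by
    obtain ⟨K, hK⟩ := hDV 0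
    refine ⟨D 0 + ∑ k ∈ Finset.range (K + 1), DeltaV M (colonIdeal I r 0) k, fun i k => ?_⟩
    have h0 := DeltaV_anti (colonIdeal_le_add I r 0 i) k
    rw [zero_add] at h0
    refine h0.trans ?_
    rcases lt_or_ge K k with hk | hk
    · rw [hK k hk]
      exact Nat.le_add_right _ _
    · exact (Finset.single_le_sum (f := fun k => DeltaV M (colonIdeal I r 0) k)
        (fun _ _ => Nat.zero_le _) (Finset.mem_range.2 (Nat.lt_succ_of_le hk))).trans
        (Nat.le_add_left _ _)
  set c := K₁ + 1 + normI i₁ with hc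
  have hbounds : ∀ N, c ≤ N →
      Δ₀ * (tauN n (N - c)).card ≤ DeltaV M I N ∧
        DeltaV M I N + B * (tauN n (N - c)).card ≤
          Δ₀ * (tauN n (N - c)).card + B * (tauN n N).card := by
    intro N hN
    rw [DeltaV_eq_sum hI hr' N]
    refine sum_tauN_bounds (i₁ := i₁) (by omega) hN (fun i => hB i _) fun j hj => ?_
    rw [mem_tauN] at hj
    rw [hf, hK₁ _ (by rw [normI_add]; omega), hDi₁]
  have hlow := (tendsto_factorial_mul_card_tauN_sub n c).const_mul (Δ₀ : ℝ)
  have hdiff := ((tendsto_factorial_mul_card_tauN_sub n 0).sub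
    (tendsto_factorial_mul_card_tauN_sub n c)).const_mul (B : ℝ)
  have hupp := hlow.add hdiff
  simp only [mul_one, sub_self, mul_zero, add_zero, Nat.sub_zero] at hlow hupp
  refine tendsto_of_tendsto_of_tendsto_of_le_of_le' hlow hupp ?_ ?_
  · filter_upwards [eventually_ge_atTop c] with N hN
    have h : (Δ₀ : ℝ) * (tauN n (N - c)).card ≤ DeltaV M I N := mod_cast (hbounds N hN).1
    rw [← mul_div_assoc, mul_left_comm]
    gcongr
  · filter_upwards [eventually_ge_atTop c] with N hN
    have h : (DeltaV M I N : ℝ) + B * (tauN n (N - c)).card ≤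
        Δ₀ * (tauN n (N - c)).card + B * (tauN n N).card := mod_cast (hbounds N hN).2
    have h' : (DeltaV M I N : ℝ) ≤ Δ₀ * (tauN n (N - c)).card +
        B * ((tauN n N).card - (tauN n (N - c)).card) := by linarith
    calc (n.factorial : ℝ) * (DeltaV M I N : ℝ) / (N : ℝ) ^ n
        ≤ n.factorial * (Δ₀ * (tauN n (N - c)).card +
            B * ((tauN n N).card - (tauN n (N - c)).card)) / (N : ℝ) ^ n := by gcongr
      _ = _ := by ring
end
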